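/- The polynomial Λ(λ₁,...,λ₆) = (λ₁−λ₂)(λ₂−λ₃)(λ₁−λ₃)(λ₄−λ₅)(λ₄−λ₆)(λ₅−λ₆), taken as the (L,L,L,M,M,M)-component of a 6-cochain (with all other components determined by skew-symmetry, and zero when the multiset of arguments differs), is a 6-cocycle in the basic complex of the W(2,2) Lie conformal algebra with trivial coefficients, and it is not a coboundary. -/

import Mathlib

open MvPolynomial

/-! ### The basic complex of the W(2,2) Lie conformal algebra `𝒲` with
trivial coefficients `ℂ`.

`𝒲` is the free `ℂ[∂]`-module on `{L, M}` with `[L_λ L] = (∂+2λ)L`,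
`[L_λ M] = (∂+2λ)M`, `[M_λ M] = 0`.  Since `𝒲` is free over `ℂ[∂]` on the
basis `{L, M}` (encoded as `Fin 2`, `0 = L`, `1 = M`), a `q`-cochain is
determined, via conformal antilinearity, by its values on basis tuples; we
encode it as a function of a basis tuple `X : Fin q → Fin 2` and values of the
variables `λ : Fin q → ℂ`, polynomial in `λ` and skew-symmetric under
simultaneous permutations. -/

abbrev WCochain (q : ℕ) : Type := (Fin q → Fin 2) → (Fin q → ℂ) → ℂ

/-- the value is polynomial in the `λ`'s. -/
def IsPolyCochain {q : ℕ} (γ : WCochain q) : Prop :=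
  ∀ X, ∃ P : MvPolynomial (Fin q) ℂ, ∀ l, γ X l = eval l P

/-- skew-symmetry with respect to simultaneous permutations of the arguments
and the variables. -/
def IsSkewCochain {q : ℕ} (γ : WCochain q) : Prop :=
  ∀ σ : Equiv.Perm (Fin q), ∀ X l,
    γ (X ∘ σ) (l ∘ σ) = (Equiv.Perm.sign σ : ℤ) * γ X l

def IsCochain {q : ℕ} (γ : WCochain q) : Prop := IsPolyCochain γ ∧ IsSkewCochain γ

/-- scalar coefficient of `[x_λ y]` for basis elements: `0` iff `x = y = M`. -/
def bcoef (x y : Fin 2) : ℂ := if x = 1 ∧ y = 1 then 0 else 1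

/-- the basis element appearing in `[x_λ y]`: `[L L] ∝ L`, `[L M] ∝ M`,
`[M L] ∝ M`. -/
def bres (x y : Fin 2) : Fin 2 := max x y

/-- the tuple `X` with entries `i` and `j` removed (`i < j`); entry `k` of the
result is given, with junk value `d` out of range. -/
def removeTwo {α : Type*} {n : ℕ} (i j : Fin n) (X : Fin n → α) (d : α) : ℕ → α :=
  fun k => (((List.ofFn X).eraseIdx j.val).eraseIdx i.val).getD k d

/-- the differential of the basic complex with trivial coefficients:
`(dγ)_{λ₁,…,λ_{q+1}}(a₁,…,a_{q+1}) = ∑_{i<j} (−1)^{i+j}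
γ_{λᵢ+λⱼ,λ₁,…,λ̂ᵢ,…,λ̂ⱼ,…}([a_{i λᵢ} a_j],a₁,…,âᵢ,…,âⱼ,…)`; for basis
arguments, `[a_{i λᵢ} a_j]` contributes the factor `(λᵢ−λⱼ)·bcoef` on the
basis element `bres` placed in the first slot (by conformal antilinearity,
since the coefficients are trivial). -/
noncomputable def dW {q : ℕ} (γ : WCochain q) : WCochain (q + 1) :=
  fun X l =>
    ∑ p ∈ Finset.univ.filter (fun p : Fin (q+1) × Fin (q+1) => p.1 < p.2),
      (-1 : ℂ) ^ (p.1.val + p.2.val) * bcoef (X p.1) (X p.2) * (l p.1 - l p.2) *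
        γ (fun k => if k.val = 0 then bres (X p.1) (X p.2)
              else removeTwo p.1 p.2 X 0 (k.val - 1))
          (fun k => if k.val = 0 then l p.1 + l p.2
              else removeTwo p.1 p.2 l 0 (k.val - 1))

/-- `dW` as a linear map. -/
noncomputable def dWLin (q : ℕ) : WCochain q →ₗ[ℂ] WCochain (q + 1) where
  toFun := dW
  map_add' γ₁ γ₂ := by
    funext X l
    simp only [dW, Pi.add_apply, mul_add, Finset.sum_add_distrib]
  map_smul' c γ := by
    funext X l
    simp only [dW, Pi.smul_apply, smul_eq_mul, RingHom.id_apply, Finset.mul_sum]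
    exact Finset.sum_congr rfl fun p _ => by ring

/-- the `ℂ`-subspace of genuine cochains. -/
noncomputable def cochainSub (q : ℕ) : Submodule ℂ (WCochain q) where
  carrier := {γ | IsCochain γ}
  add_mem' := by
    rintro a b ⟨hap, has⟩ ⟨hbp, hbs⟩
    refine ⟨fun X => ?_, fun σ X l => ?_⟩
    · obtain ⟨P, hP⟩ := hap X; obtain ⟨Q, hQ⟩ := hbp X
      exact ⟨P + Q, fun l => by simp [hP, hQ]⟩
    · have := has σ X l; have := hbs σ X l
      simp only [Pi.add_apply, *]; ring
  zero_mem' := ⟨fun X => ⟨0, by simp⟩, fun σ X l => by simp⟩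
  smul_mem' := by
    rintro c γ ⟨hp, hs⟩
    refine ⟨fun X => ?_, fun σ X l => ?_⟩
    · obtain ⟨P, hP⟩ := hp X
      exact ⟨c • P, fun l => by simp [hP]⟩
    · have := hs σ X l
      simp only [Pi.smul_apply, smul_eq_mul, *]; ring

/-- basic `q`-cocycles. -/
noncomputable def cocycleSub (q : ℕ) : Submodule ℂ (WCochain q) :=
  cochainSub q ⊓ LinearMap.ker (dWLin q)

/-- basic `q`-coboundaries. -/
noncomputable def coboundSub : (q : ℕ) → Submodule ℂ (WCochain q)
  | 0 => ⊥
  | (q + 1) => Submodule.map (dWLin q) (cochainSub q)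

/-- the `q`-th basic cohomology `H̃^q(𝒲,ℂ)`. -/
noncomputable abbrev basicH (q : ℕ) :=
  cocycleSub q ⧸ Submodule.comap (cocycleSub q).subtype (coboundSub q)

/-- the action of `∂` on the basic complex with trivial coefficients:
`(∂γ)_{λ₁,…,λ_q} = (∑ᵢ λᵢ)·γ_{λ₁,…,λ_q}`. -/
noncomputable def paW (q : ℕ) : WCochain q →ₗ[ℂ] WCochain q where
  toFun γ := fun X l => (∑ i, l i) * γ X l
  map_add' γ₁ γ₂ := by funext X l; simp [mul_add]
  map_smul' c γ := by funext X l; simp; ring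

/-- reduced `q`-cocycles: cochains `γ` with `dγ ∈ ∂C̃^{q+1}`. -/
noncomputable def redZ (q : ℕ) : Submodule ℂ (WCochain q) :=
  cochainSub q ⊓
    Submodule.comap (dWLin q) (Submodule.map (paW (q+1)) (cochainSub (q+1)))

/-- reduced `q`-coboundaries: `dC̃^{q−1} + ∂C̃^q`. -/
noncomputable def redB : (q : ℕ) → Submodule ℂ (WCochain q)
  | 0 => Submodule.map (paW 0) (cochainSub 0)
  | (q + 1) => Submodule.map (dWLin q) (cochainSub q)
      ⊔ Submodule.map (paW (q+1)) (cochainSub (q+1))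

/-- the `q`-th reduced cohomology `H^q(𝒲,ℂ)`. -/
noncomputable abbrev reducedH (q : ℕ) :=
  redZ q ⧸ Submodule.comap (redZ q).subtype (redB q)

theorem removeTwo_eq_apply {α : Type*} {n : ℕ} (i j : Fin (n + 1)) (X : Fin (n + 1) → α) (d : α)
    (k : ℕ) (hij : i < j) (hk : k + 1 < n) :
    removeTwo i j X d k = X (removeTwo i j id 0 k) := by
  unfold removeTwo
  have h : List.ofFn X = (List.ofFn id).map X := by rw [List.map_ofFn]; rfl
  have hij' : i.val < j.val := hij
  have hj : ((List.ofFn (id : Fin (n + 1) → Fin (n + 1))).eraseIdx j.val).length = n := by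
    rw [List.length_eraseIdx_of_lt (by simpa using j.isLt), List.length_ofFn, Nat.add_sub_cancel]
  have hlen : k < (((List.ofFn (id : Fin (n + 1) → Fin (n + 1))).eraseIdx j.val).eraseIdx
      i.val).length := by
    rw [List.length_eraseIdx_of_lt (by omega), hj]
    omega
  rw [h, List.eraseIdx_map, List.eraseIdx_map, List.getD_eq_getElem _ _ (by simpa using hlen),
    List.getD_eq_getElem _ _ hlen, List.getElem_map]

/-- The increasing enumeration of the indices different from `i` and `j`. -/
def skipTwo (i j : Fin 7) (k : Fin 5) : Fin 7 := removeTwo i j id 0 k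

theorem skipTwo_castSucc_succ : ∀ (i j : Fin 6) (k : Fin 5), i ≤ j →
    skipTwo i.castSucc j.succ k = i.castSucc.succAbove (j.succAbove k) := by
  decide

theorem skipTwo_castSucc_succ' : ∀ (i j : Fin 6) (k : Fin 5), i ≤ j →
    skipTwo i.castSucc j.succ k = j.succ.succAbove (i.succAbove k) := by
  decide

theorem sum_lt_eq_sum_le (g : Fin 7 → Fin 7 → ℂ) :
    ∑ p ∈ Finset.univ.filter (fun p : Fin 7 × Fin 7 => p.1 < p.2), g p.1 p.2 =
      ∑ i : Fin 6, ∑ j : Fin 6, if i ≤ j then g i.castSucc j.succ else 0 := by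
  rw [Finset.sum_filter, Fintype.sum_prod_type, Fin.sum_univ_castSucc]
  simp only [Fin.sum_univ_succ (n := 6), Fin.not_lt_zero, if_false, zero_add,
    Fin.castSucc_lt_succ_iff]
  simp [(Fin.le_last _).not_gt, -Fin.reduceLast]

theorem sum_eq_sum_le (h : Fin 7 → Fin 6 → ℂ) :
    ∑ i, ∑ j, h i j =
      ∑ i : Fin 6, ∑ j : Fin 6, if i ≤ j then h i.castSucc j + h j.succ i else 0 := by
  have h_lt : ∑ i, ∑ j, (if i ≤ j.castSucc then h i j else 0) =
      ∑ i : Fin 6, ∑ j : Fin 6, if i ≤ j then h i.castSucc j else 0 := by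
    rw [Fin.sum_univ_castSucc]
    simp [(Fin.castSucc_lt_last _).not_ge, -Fin.reduceLast]
  have h_gt : ∑ i, ∑ j, (if j.castSucc < i then h i j else 0) =
      ∑ i : Fin 6, ∑ j : Fin 6, if i ≤ j then h j.succ i else 0 := by
    rw [Fin.sum_univ_succ, Finset.sum_comm (s := (Finset.univ : Finset (Fin 6)))]
    simp [Fin.castSucc_lt_succ_iff]
  calc ∑ i, ∑ j, h i j = ∑ i, ∑ j : Fin 6,
        ((if i ≤ j.castSucc then h i j else 0) + if j.castSucc < i then h i j else 0) := by
        refine Finset.sum_congr rfl fun i _ => Finset.sum_congr rfl fun j _ => ?_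
        by_cases hij : i ≤ j.castSucc
        · simp [hij, hij.not_gt]
        · simp [hij, not_le.1 hij]
    _ = _ := by
        simp only [Finset.sum_add_distrib, h_lt, h_gt]
        simp only [← Finset.sum_add_distrib]
        refine Finset.sum_congr rfl fun i _ => Finset.sum_congr rfl fun j _ => ?_
        split_ifs <;> simp

theorem sum_wedge_mul_minor (B : Matrix (Fin 7) (Fin 5) ℂ) (u w : Fin 7 → ℂ) :
    ∑ p ∈ Finset.univ.filter (fun p : Fin 7 × Fin 7 => p.1 < p.2),
      (-1 : ℂ) ^ (p.1.val + p.2.val) * (u p.1 * w p.2 - u p.2 * w p.1) *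
        (B.submatrix (skipTwo p.1 p.2) id).det =
      -(Matrix.of fun i => (Fin.cons (u i) (Fin.cons (w i) (B i)) : Fin 7 → ℂ)).det := by
  have key : (Matrix.of fun i => (Fin.cons (u i) (Fin.cons (w i) (B i)) : Fin 7 → ℂ)).det =
      ∑ i : Fin 7, ∑ j : Fin 6, (-1) ^ (i.val + j.val) * u i * w (i.succAbove j) *
        (B.submatrix (fun k => i.succAbove (j.succAbove k)) id).det := by
    rw [Matrix.det_succ_column_zero]
    refine Finset.sum_congr rfl fun i _ => ?_
    rw [Matrix.det_succ_column_zero, Finset.mul_sum]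
    refine Finset.sum_congr rfl fun j _ => ?_
    simp only [Matrix.of_apply, Fin.cons_zero, Matrix.submatrix_apply, Fin.cons_succ, pow_add,
      Matrix.submatrix_submatrix]
    have : (Matrix.of fun i => (Fin.cons (u i) (Fin.cons (w i) (B i)) : Fin 7 → ℂ)).submatrix
        (i.succAbove ∘ j.succAbove) (Fin.succ ∘ Fin.succ) =
        B.submatrix (fun k => i.succAbove (j.succAbove k)) id := by
      ext a b
      simp
    rw [this]
    simp
    ring
  rw [key, sum_eq_sum_le, sum_lt_eq_sum_le (fun i j => (-1 : ℂ) ^ (i.val + j.val) *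
    (u i * w j - u j * w i) * (B.submatrix (skipTwo i j) id).det), ← Finset.sum_neg_distrib]
  refine Finset.sum_congr rfl fun i _ => ?_
  rw [← Finset.sum_neg_distrib]
  refine Finset.sum_congr rfl fun j _ => ?_
  split_ifs with hij
  · rw [← funext fun k => skipTwo_castSucc_succ i j k hij,
      ← funext fun k => skipTwo_castSucc_succ' i j k hij,
      Fin.succAbove_of_le_castSucc _ _ (Fin.castSucc_le_castSucc_iff.2 hij),
      Fin.succAbove_of_castSucc_lt _ _ (Fin.castSucc_lt_succ_iff.2 hij)]
    simp only [Fin.val_castSucc, Fin.val_succ, pow_add, pow_one]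
    ring
  · simp

theorem sum_wedge_column_mul_minor (B : Matrix (Fin 7) (Fin 5) ℂ) (u : Fin 7 → ℂ) (b : Fin 5) :
    ∑ p ∈ Finset.univ.filter (fun p : Fin 7 × Fin 7 => p.1 < p.2),
      (-1 : ℂ) ^ (p.1.val + p.2.val) * (u p.1 * B p.2 b - u p.2 * B p.1 b) *
        (B.submatrix (skipTwo p.1 p.2) id).det = 0 := by
  rw [sum_wedge_mul_minor B u fun i => B i b, neg_eq_zero]
  have hb : ∀ b : Fin 5, (1 : Fin 7) ≠ b.succ.succ := by decide
  refine Matrix.det_zero_of_column_eq (hb b) fun k => ?_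
  simp only [Matrix.of_apply, Fin.cons_succ]
  rfl

/-- The row attached to the argument `(x, l)`: the powers `1, l, l ^ 2`, placed in the first
three coordinates if `x = L` and in the last three if `x = M`. -/
noncomputable def powerRow (x : Fin 2) (l : ℂ) : Fin 6 → ℂ :=
  ![if x = 0 then 1 else 0, if x = 0 then l else 0, if x = 0 then l ^ 2 else 0,
    if x = 1 then 1 else 0, if x = 1 then l else 0, if x = 1 then l ^ 2 else 0]

/-- The cochain `(λ₁−λ₂)(λ₂−λ₃)(λ₁−λ₃)(λ₄−λ₅)(λ₄−λ₆)(λ₅−λ₆)` as a determinant. -/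
noncomputable def detCochain : WCochain 6 := fun X l =>
  (Matrix.of fun i => powerRow (X i) (l i)).det

theorem isCochain_detCochain : IsCochain detCochain := by
  refine ⟨fun X => ?_, fun σ X l => ?_⟩
  · refine ⟨(Matrix.of fun i : Fin 6 => (![if X i = 0 then 1 else 0, if X i = 0 then .X i else 0,
      if X i = 0 then .X i ^ 2 else 0, if X i = 1 then 1 else 0, if X i = 1 then .X i else 0,
      if X i = 1 then .X i ^ 2 else 0] : Fin 6 → MvPolynomial (Fin 6) ℂ)).det, fun l => ?_⟩
    rw [RingHom.map_det, detCochain]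
    congr 1
    ext i j
    obtain h | h : X i = 0 ∨ X i = 1 := by omega
    all_goals fin_cases j <;> simp [powerRow, h]
  · exact Matrix.det_permute σ (Matrix.of fun i => powerRow (X i) (l i))

theorem detCochain_apply (l : Fin 6 → ℂ) :
    detCochain ![0, 0, 0, 1, 1, 1] l = (l 0 - l 1) * (l 1 - l 2) * (l 0 - l 2)
      * (l 3 - l 4) * (l 3 - l 5) * (l 4 - l 5) := by
  simp [detCochain, powerRow, Matrix.det_succ_row_zero, Fin.sum_univ_succ, Fin.succAbove]
  ring

theorem detCochain_eq_zero (X : Fin 6 → Fin 2)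
    (hX : (Finset.univ.filter fun i => X i = 0).card ≠ 3) (l : Fin 6 → ℂ) :
    detCochain X l = 0 := by
  rw [detCochain, Matrix.det_apply]
  refine Finset.sum_eq_zero fun σ _ => ?_
  rw [smul_eq_zero_iff_eq, Finset.prod_eq_zero_iff]
  by_contra! h
  have hσ : ∀ j, X (σ j) = ![0, 0, 0, 1, 1, 1] j := by
    intro j
    by_contra hj
    refine h j (Finset.mem_univ _) ?_
    fin_cases j <;> simp_all [powerRow]
  refine hX ?_
  rw [← Finset.card_map σ.symm.toEmbedding]
  have : (Finset.univ.filter fun i => X i = 0).map σ.symm.toEmbedding =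
      Finset.univ.filter fun i => (![0, 0, 0, 1, 1, 1] : Fin 6 → Fin 2) i = 0 := by
    ext j
    simp [← hσ]
  rw [this]
  decide

theorem bracket_powerRow (c : Fin 6) : ∃ u : Fin 5 → Fin 2 → ℂ → ℂ, ∀ x y l m,
    bcoef x y * (l - m) * powerRow (bres x y) (l + m) c =
      ∑ b, (u b x l * powerRow y m (c.succAbove b) - u b y m * powerRow x l (c.succAbove b)) := by
  let E (k : ℕ) (x : Fin 2) (l : ℂ) : ℂ := if x = 0 then l ^ k else 0
  let F (k : ℕ) (x : Fin 2) (l : ℂ) : ℂ := if x = 1 then l ^ k else 0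
  refine ⟨(![![-E 0, 0, 0, 0, 0], ![E 2, 0, 0, 0, 0], ![E 3, E 2, 0, 0, 0],
    ![F 1, -F 0, 0, 0, 0], ![F 2, 0, 0, E 2, 0], ![F 3, F 2, 0, E 3, E 2]] :
    Fin 6 → Fin 5 → Fin 2 → ℂ → ℂ) c, fun x y l m => ?_⟩
  fin_cases c <;> fin_cases x <;> fin_cases y <;>
    simp [E, F, bcoef, bres, powerRow, Fin.sum_univ_succ, Fin.succAbove] <;> ring

theorem detCochain_bracket (X : Fin 7 → Fin 2) (l : Fin 7 → ℂ) (i j : Fin 7) (hij : i < j) :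
    detCochain
        (fun k => if k.val = 0 then bres (X i) (X j) else removeTwo i j X 0 (k.val - 1))
        (fun k => if k.val = 0 then l i + l j else removeTwo i j l 0 (k.val - 1)) =
      ∑ c : Fin 6, (-1) ^ c.val * powerRow (bres (X i) (X j)) (l i + l j) c *
        ((Matrix.of fun i b => powerRow (X i) (l i) (c.succAbove b)).submatrix
          (skipTwo i j) id).det := by
  rw [detCochain, Matrix.det_succ_row_zero]
  refine Finset.sum_congr rfl fun c _ => ?_
  congr 2
  ext a b
  simp only [Matrix.submatrix_apply, Matrix.of_apply, Fin.val_succ, Nat.succ_ne_zero, if_false,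
    Nat.add_sub_cancel, skipTwo, id]
  rw [removeTwo_eq_apply i j X 0 a hij (by omega), removeTwo_eq_apply i j l 0 a hij (by omega)]

theorem dW_detCochain : dW detCochain = 0 := by
  funext X l
  choose u hu using bracket_powerRow
  have h : dW detCochain X l = ∑ c : Fin 6, (-1) ^ c.val * ∑ b : Fin 5,
      ∑ p ∈ Finset.univ.filter (fun p : Fin 7 × Fin 7 => p.1 < p.2),
        (-1 : ℂ) ^ (p.1.val + p.2.val) *
          (u c b (X p.1) (l p.1) * powerRow (X p.2) (l p.2) (c.succAbove b) -
            u c b (X p.2) (l p.2) * powerRow (X p.1) (l p.1) (c.succAbove b)) *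
          ((Matrix.of fun i b => powerRow (X i) (l i) (c.succAbove b)).submatrix
            (skipTwo p.1 p.2) id).det := by
    rw [Finset.sum_congr rfl fun (c : Fin 6) _ =>
      congrArg (fun z : ℂ => (-1) ^ c.val * z) Finset.sum_comm]
    simp only [Finset.mul_sum]
    rw [Finset.sum_comm]
    refine Finset.sum_congr rfl fun p hp => ?_
    rw [detCochain_bracket X l p.1 p.2 (Finset.mem_filter.1 hp).2, Finset.mul_sum]
    refine Finset.sum_congr rfl fun c _ => ?_
    rw [← Finset.mul_sum, ← Finset.sum_mul, ← Finset.mul_sum, ← hu]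
    ring
  rw [h]
  refine Finset.sum_eq_zero fun c _ => ?_
  rw [Finset.sum_eq_zero, mul_zero]
  exact fun b _ => sum_wedge_column_mul_minor
    (Matrix.of fun i b => powerRow (X i) (l i) (c.succAbove b)) (fun i => u c b (X i) (l i)) b

section Divisibility

variable {n : ℕ} (i j : Fin n)

theorem X_sub_X_dvd_sub_bind₁ (Q : MvPolynomial (Fin n) ℂ) :
    (X i - X j : MvPolynomial (Fin n) ℂ) ∣
      Q - bind₁ (fun k => if k = i then X j else X k) Q := by
  rw [← Ideal.mem_span_singleton, ← Ideal.Quotient.mk_eq_mk_iff_sub_mem]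
  induction Q using MvPolynomial.induction_on with
  | C a => simp
  | add p q hp hq => simp only [map_add, hp, hq]
  | mul_X p k hp =>
    rw [map_mul, map_mul, map_mul, hp, bind₁_X_right]
    split_ifs with hk
    · rw [hk, Ideal.Quotient.mk_eq_mk_iff_sub_mem (X i) (X j) |>.2
        (Ideal.mem_span_singleton_self _)]
    · rfl

theorem X_sub_X_dvd_of_eval_mul_eq_zero (A Q : MvPolynomial (Fin n) ℂ)
    (hA : ∃ l : Fin n → ℂ, l i = l j ∧ eval l A ≠ 0)
    (h : ∀ l : Fin n → ℂ, l i = l j → eval l (A * Q) = 0) :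
    (X i - X j : MvPolynomial (Fin n) ℂ) ∣ Q := by
  set s : Fin n → MvPolynomial (Fin n) ℂ := fun k => if k = i then X j else X k with hs
  have heval : ∀ (l : Fin n → ℂ) (P : MvPolynomial (Fin n) ℂ),
      eval l (bind₁ s P) = eval (fun k => if k = i then l j else l k) P := by
    intro l P
    have : (fun k => if k = i then l j else l k) = fun k => eval l (s k) := by
      funext k
      simp only [hs]
      split_ifs <;> simp
    rw [this, ← coe_aeval_eq_eval, ← coe_aeval_eq_eval, RingHom.coe_coe, RingHom.coe_coe,
      aeval_bind₁]
  have hAQ : bind₁ s A * bind₁ s Q = 0 := by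
    rw [← map_mul]
    refine MvPolynomial.funext fun l => ?_
    rw [heval, h _ (by simp), map_zero]
  have hA0 : bind₁ s A ≠ 0 := by
    obtain ⟨l, hl, hlA⟩ := hA
    refine fun h0 => hlA ?_
    have : (fun k => if k = i then l j else l k) = l := by
      funext k
      split_ifs with hk
      · rw [hk, hl]
      · rfl
    rw [← this, ← heval, h0, map_zero]
  have hdvd := X_sub_X_dvd_sub_bind₁ i j Q
  rwa [(mul_eq_zero.1 hAQ).resolve_left hA0, sub_zero] at hdvd

end Divisibility

theorem exists_eval_mul_eq {n : ℕ} (R : MvPolynomial (Fin n) ℂ) :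
    ∃ (a : ℂ) (c : Fin n → ℂ) (S : (Fin n → ℂ) → Polynomial ℂ), ∀ (p : Fin n → ℂ) (t : ℂ),
      eval (fun i => t * p i) R = a + t * ∑ i, c i * p i + t ^ 2 * (S p).eval t := by
  induction R using MvPolynomial.induction_on with
  | C a => exact ⟨a, 0, 0, by simp⟩
  | add P Q hP hQ =>
    obtain ⟨a, c, S, h⟩ := hP
    obtain ⟨a', c', S', h'⟩ := hQ
    refine ⟨a + a', c + c', S + S', fun p t => ?_⟩
    simp only [map_add, h, h', Pi.add_apply, add_mul, Finset.sum_add_distrib, Polynomial.eval_add]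
    ring
  | mul_X P k hP =>
    obtain ⟨a, c, S, h⟩ := hP
    refine ⟨0, Pi.single k a, fun p => Polynomial.C (p k) *
      (Polynomial.C (∑ i, c i * p i) + Polynomial.X * S p), fun p t => ?_⟩
    simp only [map_mul, h, eval_X, Pi.single_apply, ite_mul, zero_mul, Finset.sum_ite_eq',
      Finset.mem_univ, if_true, Polynomial.eval_mul, Polynomial.eval_add, Polynomial.eval_C,
      Polynomial.eval_X]
    ring

theorem linear_coeff_eq_zero (a b : ℂ) (S : Polynomial ℂ)
    (h : ∀ t : ℂ, t ≠ 0 → a + t * b + t ^ 2 * S.eval t = 0) : b = 0 := by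
  have h0 : Polynomial.X * (Polynomial.C a + Polynomial.X * Polynomial.C b +
      Polynomial.X ^ 2 * S) = 0 := by
    refine Polynomial.funext fun t => ?_
    by_cases ht : t = 0
    · simp [ht]
    · simpa [ht, mul_comm b] using h t ht
  have h1 := (mul_eq_zero.1 h0).resolve_left Polynomial.X_ne_zero
  have h2 := congrArg (fun P => Polynomial.coeff P 1) h1
  simpa [pow_two, mul_assoc, Polynomial.coeff_X_mul] using h2

theorem eval_skew_eq_vandermonde_mul {φ : WCochain 5} (hφ : IsCochain φ) :
    ∃ R : MvPolynomial (Fin 5) ℂ, ∀ l : Fin 5 → ℂ, φ ![0, 0, 1, 1, 1] l =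
      (l 0 - l 1) * (l 2 - l 3) * (l 2 - l 4) * (l 3 - l 4) * eval l R := by
  obtain ⟨P, hP⟩ := hφ.1 ![0, 0, 1, 1, 1]
  have hvanish : ∀ i j : Fin 5, i ≠ j →
      (![0, 0, 1, 1, 1] : Fin 5 → Fin 2) ∘ Equiv.swap i j = ![0, 0, 1, 1, 1] →
      ∀ l : Fin 5 → ℂ, l i = l j → eval l P = 0 := by
    intro i j hij hX l hl
    have h := hφ.2 (Equiv.swap i j) ![0, 0, 1, 1, 1] l
    have hl' : l ∘ Equiv.swap i j = l := by
      rw [Equiv.comp_swap_eq_update, hl, Function.update_eq_self, ← hl, Function.update_eq_self]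
    rw [hX, hl', Equiv.Perm.sign_swap hij, hP] at h
    push_cast at h
    linear_combination h / 2
  obtain ⟨Q₁, rfl⟩ := X_sub_X_dvd_of_eval_mul_eq_zero 0 1 1 P ⟨0, by simp⟩ fun l hl => by
    rw [one_mul, hvanish 0 1 (by decide) (by decide) l hl]
  obtain ⟨Q₂, rfl⟩ := X_sub_X_dvd_of_eval_mul_eq_zero 2 3 (X 0 - X 1) Q₁
    ⟨![0, 1, 0, 0, 0], by simp⟩ fun l hl => hvanish 2 3 (by decide) (by decide) l hl
  obtain ⟨Q₃, rfl⟩ := X_sub_X_dvd_of_eval_mul_eq_zero 2 4 ((X 0 - X 1) * (X 2 - X 3)) Q₂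
    ⟨![0, 1, 0, 1, 0], by simp⟩ fun l hl => by
      rw [mul_assoc, hvanish 2 4 (by decide) (by decide) l hl]
  obtain ⟨Q₄, rfl⟩ := X_sub_X_dvd_of_eval_mul_eq_zero 3 4
    ((X 0 - X 1) * (X 2 - X 3) * (X 2 - X 4)) Q₃
    ⟨![0, 1, 0, 1, 1], by simp⟩ fun l hl => by
      rw [mul_assoc, mul_assoc, hvanish 3 4 (by decide) (by decide) l hl]
  refine ⟨Q₄, fun l => ?_⟩
  rw [hP]
  simp only [map_mul, map_sub, eval_X]
  ring

theorem exists_expansion {φ : WCochain 5} (hφ : IsCochain φ) :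
    ∃ (a b c : ℂ) (S : (Fin 5 → ℂ) → Polynomial ℂ), ∀ t x₀ x₁ y₀ y₁ y₂ : ℂ,
      φ ![0, 0, 1, 1, 1] ![t * x₀, t * x₁, t * y₀, t * y₁, t * y₂] =
        t ^ 4 * ((x₀ - x₁) * (y₀ - y₁) * (y₀ - y₂) * (y₁ - y₂)) *
          (a + t * (b * (x₀ + x₁) + c * (y₀ + y₁ + y₂)) +
            t ^ 2 * (S ![x₀, x₁, y₀, y₁, y₂]).eval t) := by
  obtain ⟨R, hR⟩ := eval_skew_eq_vandermonde_mul hφ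
  obtain ⟨a, c, S, hS⟩ := exists_eval_mul_eq R
  have hφR : ∀ (t : ℂ) (p : Fin 5 → ℂ), φ ![0, 0, 1, 1, 1] (fun i => t * p i) =
      t ^ 4 * ((p 0 - p 1) * (p 2 - p 3) * (p 2 - p 4) * (p 3 - p 4)) *
        (a + t * ∑ i, c i * p i + t ^ 2 * (S p).eval t) := by
    intro t p
    rw [hR, hS]
    ring
  have hc : ∀ i j : Fin 5, i ≠ j →
      (![0, 0, 1, 1, 1] : Fin 5 → Fin 2) ∘ Equiv.swap i j = ![0, 0, 1, 1, 1] →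
      ∀ q : Fin 5 → ℂ, ![0, 1, 0, 1, 2] ∘ Equiv.swap i j = q →
      (q 0 - q 1) * (q 2 - q 3) * (q 2 - q 4) * (q 3 - q 4) = -2 →
      ∑ k, c k * (![0, 1, 0, 1, 2] : Fin 5 → ℂ) k - ∑ k, c k * q k = 0 := by
    intro i j hij hX q hq hV
    refine linear_coeff_eq_zero 0 _ (S ![0, 1, 0, 1, 2] - S q) fun t ht => ?_
    have h := hφ.2 (Equiv.swap i j) ![0, 0, 1, 1, 1]
      fun i => t * (![0, 1, 0, 1, 2] : Fin 5 → ℂ) i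
    have hcomp : (fun i => t * (![0, 1, 0, 1, 2] : Fin 5 → ℂ) i) ∘ Equiv.swap i j =
        fun i => t * q i := by
      rw [← hq]
      rfl
    have hV' : ((![0, 1, 0, 1, 2] : Fin 5 → ℂ) 0 - (![0, 1, 0, 1, 2] : Fin 5 → ℂ) 1) *
        ((![0, 1, 0, 1, 2] : Fin 5 → ℂ) 2 - (![0, 1, 0, 1, 2] : Fin 5 → ℂ) 3) *
        ((![0, 1, 0, 1, 2] : Fin 5 → ℂ) 2 - (![0, 1, 0, 1, 2] : Fin 5 → ℂ) 4) *
        ((![0, 1, 0, 1, 2] : Fin 5 → ℂ) 3 - (![0, 1, 0, 1, 2] : Fin 5 → ℂ) 4) = 2 := by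
      simp
      norm_num
    rw [hX, hcomp, Equiv.Perm.sign_swap hij, hφR, hφR, hV, hV'] at h
    push_cast at h
    rw [Polynomial.eval_sub]
    refine mul_left_cancel₀ (pow_ne_zero 4 ht) ?_
    linear_combination h / 2
  have h01 := hc 0 1 (by decide) (by decide) ![1, 0, 0, 1, 2]
    (by ext k; fin_cases k <;> rfl) (by simp; norm_num)
  have h23 := hc 2 3 (by decide) (by decide) ![0, 1, 1, 0, 2]
    (by ext k; fin_cases k <;> rfl) (by simp; norm_num)
  have h34 := hc 3 4 (by decide) (by decide) ![0, 1, 0, 2, 1]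
    (by ext k; fin_cases k <;> rfl) (by simp; norm_num)
  simp [Fin.sum_univ_five] at h01 h23 h34
  refine ⟨a, c 0, c 2, S, fun t x₀ x₁ y₀ y₁ y₂ => ?_⟩
  have hx : ![t * x₀, t * x₁, t * y₀, t * y₁, t * y₂] =
      fun i => t * (![x₀, x₁, y₀, y₁, y₂] : Fin 5 → ℂ) i := by
    ext k
    fin_cases k <;> rfl
  have h1 : c 1 = c 0 := by linear_combination h01
  have h3 : c 3 = c 2 := by linear_combination h23
  have h4 : c 4 = c 2 := by linear_combination h34 + h23
  rw [hx, hφR, Fin.sum_univ_five, h1, h3, h4]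
  simp only [Matrix.cons_val]
  ring

theorem dW_apply_LLLMMM {φ : WCochain 5} (hφ : IsSkewCochain φ) (l₀ l₁ l₂ m₀ m₁ m₂ : ℂ) :
    dW φ ![0, 0, 0, 1, 1, 1] ![l₀, l₁, l₂, m₀, m₁, m₂] =
      -((l₀ - l₁) * φ ![0, 0, 1, 1, 1] ![l₀ + l₁, l₂, m₀, m₁, m₂])
      + (l₀ - l₂) * φ ![0, 0, 1, 1, 1] ![l₀ + l₂, l₁, m₀, m₁, m₂]
      - (l₁ - l₂) * φ ![0, 0, 1, 1, 1] ![l₁ + l₂, l₀, m₀, m₁, m₂]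
      - (l₀ - m₀) * φ ![0, 0, 1, 1, 1] ![l₁, l₂, l₀ + m₀, m₁, m₂]
      + (l₀ - m₁) * φ ![0, 0, 1, 1, 1] ![l₁, l₂, l₀ + m₁, m₀, m₂]
      - (l₀ - m₂) * φ ![0, 0, 1, 1, 1] ![l₁, l₂, l₀ + m₂, m₀, m₁]
      + (l₁ - m₀) * φ ![0, 0, 1, 1, 1] ![l₀, l₂, l₁ + m₀, m₁, m₂]
      - (l₁ - m₁) * φ ![0, 0, 1, 1, 1] ![l₀, l₂, l₁ + m₁, m₀, m₂]
      + (l₁ - m₂) * φ ![0, 0, 1, 1, 1] ![l₀, l₂, l₁ + m₂, m₀, m₁]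
      - (l₂ - m₀) * φ ![0, 0, 1, 1, 1] ![l₀, l₁, l₂ + m₀, m₁, m₂]
      + (l₂ - m₁) * φ ![0, 0, 1, 1, 1] ![l₀, l₁, l₂ + m₁, m₀, m₂]
      - (l₂ - m₂) * φ ![0, 0, 1, 1, 1] ![l₀, l₁, l₂ + m₂, m₀, m₁] := by
  have hrot : ∀ a b c d e : ℂ,
      φ ![1, 0, 0, 1, 1] ![a, b, c, d, e] = φ ![0, 0, 1, 1, 1] ![b, c, a, d, e] := by
    intro a b c d e
    have h := hφ (Equiv.swap 0 1 * Equiv.swap 1 2) ![1, 0, 0, 1, 1] ![a, b, c, d, e]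
    rw [Equiv.Perm.sign_mul, Equiv.Perm.sign_swap (by decide),
      Equiv.Perm.sign_swap (by decide)] at h
    have hX : (![1, 0, 0, 1, 1] : Fin 5 → Fin 2) ∘
        (Equiv.swap 0 1 * Equiv.swap 1 2 : Equiv.Perm (Fin 5)) = ![0, 0, 1, 1, 1] := by decide
    have hl : ![a, b, c, d, e] ∘ (Equiv.swap 0 1 * Equiv.swap 1 2 : Equiv.Perm (Fin 5)) =
        ![b, c, a, d, e] := by
      ext k
      fin_cases k <;> rfl
    rw [hX, hl] at h
    simpa using h.symm
  have hvec : ∀ {α : Type} (f : Fin 5 → α), f = ![f 0, f 1, f 2, f 3, f 4] := by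
    intro α f
    ext k
    fin_cases k <;> rfl
  rw [dW, Finset.sum_filter, Fintype.sum_prod_type]
  simp only [hvec (fun k : Fin 5 => if k.val = 0 then _ else _)]
  simp [Fin.sum_univ_six, removeTwo, bcoef, bres, hrot]
  ring

theorem dW_ne_detCochain {φ : WCochain 5} (hφ : IsCochain φ) : dW φ ≠ detCochain := by
  intro h
  obtain ⟨a, b, c, S, hS⟩ := exists_expansion hφ
  have h0 := linear_coeff_eq_zero 0 (-4) (Polynomial.C (2) * S ![0 + 1, 2, 0, 1, 2] +
      Polynomial.C (4) * S ![0 + 2, 1, 0, 1, 2] +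
      Polynomial.C (2) * S ![1, 2, 0 + 1, 0, 2] +
      Polynomial.C (4) * S ![1, 2, 0 + 2, 0, 1] +
      Polynomial.C (-6) * S ![1 + 2, 0, 0, 1, 2] +
      Polynomial.C (-12) * S ![0, 2, 1 + 2, 0, 1] +
      Polynomial.C (6) * S ![0, 1, 2 + 1, 0, 2]) fun t ht => by
    have ht' := dW_apply_LLLMMM hφ.2 (t * 0) (t * 1) (t * 2) (t * 0) (t * 1) (t * 2)
    rw [h, detCochain_apply] at ht'
    simp only [← mul_add, hS, Matrix.cons_val] at ht'
    simp only [Polynomial.eval_add, Polynomial.eval_mul, Polynomial.eval_C]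
    refine mul_left_cancel₀ (pow_ne_zero 5 ht) ?_
    linear_combination -ht'
  norm_num at h0

/-- the 6-cochain `γ` whose `(L,L,L,M,M,M)`-component is
`Λ = (λ₁−λ₂)(λ₂−λ₃)(λ₁−λ₃)(λ₄−λ₅)(λ₄−λ₆)(λ₅−λ₆)` (all other components
determined by skew-symmetry, and zero when the multiset of arguments is not
`{L,L,L,M,M,M}`) is a 6-cocycle in the basic complex of `𝒲` with trivial
coefficients, and it is not a coboundary.  (`0 = L`, `1 = M`.) -/
theorem stmt19 :
    ∃ γ : WCochain 6, IsCochain γ ∧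
      (∀ l : Fin 6 → ℂ,
        γ ![0, 0, 0, 1, 1, 1] l
          = (l 0 - l 1) * (l 1 - l 2) * (l 0 - l 2)
            * (l 3 - l 4) * (l 3 - l 5) * (l 4 - l 5)) ∧
      (∀ X : Fin 6 → Fin 2,
        (Finset.univ.filter fun i => X i = 0).card ≠ 3 → ∀ l, γ X l = 0) ∧
      dW γ = 0 ∧
      ¬ ∃ φ : WCochain 5, IsCochain φ ∧ dW φ = γ := by
  exact ⟨detCochain, isCochain_detCochain, detCochain_apply, detCochain_eq_zero, dW_detCochain,
    fun ⟨_, hφ, h⟩ => dW_ne_detCochain hφ h⟩
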